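/- Let C = {0,1}^n, let k = ⌊n/2⌋, and let p be a polynomial of total degree at most 2 that is nonnegative at every point of C. Then there exists a function h : C → ℝ that is k-sos on C and not identically zero on C such that p·h is (k+1)-sos on C (i.e., p is (k+1)-rsos on C). -/

import Mathlib

/-- The hypercube `{0,1}^n ⊆ ℝ^n`. -/
def cube (n : ℕ) : Set (Fin n → ℝ) := {x | ∀ i, x i = 0 ∨ x i = 1}

/-- `f` is `k`-sos on `X`: a finite sum of squares of polynomials of total degree ≤ `k`,
as a function on `X`. -/
def IsSosOn (n : ℕ) (X : Set (Fin n → ℝ)) (k : ℕ) (f : (Fin n → ℝ) → ℝ) : Prop :=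
  ∃ (m : ℕ) (g : Fin m → MvPolynomial (Fin n) ℝ),
    (∀ i, (g i).totalDegree ≤ k) ∧ ∀ x ∈ X, f x = ∑ i, (MvPolynomial.eval x (g i)) ^ 2

/-- In finite dimension, the convex hull of a compact set is compact. -/
theorem isCompact_convexHull_of_finiteDimensional {E : Type*} [NormedAddCommGroup E]
    [NormedSpace ℝ E] [FiniteDimensional ℝ E] {s : Set E} (hs : IsCompact s) :
    IsCompact (convexHull ℝ s) := by
  have key : convexHull ℝ s = ⋃ m ∈ Finset.range (Module.finrank ℝ E + 2),
      (fun q : (Fin m → ℝ) × (Fin m → E) => ∑ i, q.1 i • q.2 i) ''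
        (stdSimplex ℝ (Fin m) ×ˢ Set.univ.pi fun _ => s) := by
    apply Set.Subset.antisymm
    · intro x hx
      obtain ⟨ι, _, z, w, hz, hind, hw, hw1, hx⟩ := eq_pos_convex_span_of_mem_convexHull hx
      have hcard : Fintype.card ι ≤ Module.finrank ℝ E + 1 :=
        hind.card_le_finrank_succ.trans (Nat.succ_le_succ (Submodule.finrank_le _))
      let e := (Fintype.equivFin ι).symm
      simp only [Set.mem_iUnion]
      refine ⟨Fintype.card ι, Finset.mem_range.2 (by omega), (w ∘ e, z ∘ e),
        ⟨⟨fun i => (hw _).le, ?_⟩, fun i _ => hz ⟨_, rfl⟩⟩, ?_⟩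
      · simpa [Function.comp_def] using (e.sum_comp w).trans hw1
      · simpa [Function.comp_def] using (e.sum_comp fun i => w i • z i).trans hx
    · simp only [Set.iUnion_subset_iff]
      rintro m - _ ⟨⟨w, z⟩, ⟨⟨hw, hw1⟩, hz⟩, rfl⟩
      exact (convex_convexHull ℝ s).sum_mem (fun i _ => hw i) hw1
        fun i _ => subset_convexHull ℝ s (hz i trivial)
  rw [key]
  refine (Finset.range _).isCompact_biUnion fun m _ => ?_
  exact ((isCompact_stdSimplex ℝ (Fin m)).prod (isCompact_univ_pi fun _ => hs)).image (by fun_prop)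

/-- A space of functions on which a diagonal quadratic form is positive definite injects into the
functions on the coordinates of positive weight. -/
theorem card_le_card_pos_of_forall_sum_pos {ι X : Type*} [Fintype ι] [Fintype X]
    (A : (ι → ℝ) →ₗ[ℝ] (X → ℝ)) (w : X → ℝ)
    (h : ∀ a, a ≠ 0 → 0 < ∑ x, w x * A a x ^ 2) :
    Fintype.card ι ≤ (Finset.univ.filter fun x => 0 < w x).card := by
  classical
  let R : (ι → ℝ) →ₗ[ℝ] ({x // 0 < w x} → ℝ) := LinearMap.funLeft ℝ ℝ Subtype.val ∘ₗ A
  have hR : Function.Injective R := by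
    rw [← LinearMap.ker_eq_bot, LinearMap.ker_eq_bot']
    intro a ha
    by_contra hne
    refine (h a hne).not_ge (Finset.sum_nonpos fun x _ => ?_)
    by_cases hx : 0 < w x
    · have : A a x = 0 := congrFun ha ⟨x, hx⟩
      simp [this]
    · exact mul_nonpos_of_nonpos_of_nonneg (not_lt.1 hx) (sq_nonneg _)
  simpa [Fintype.card_subtype] using LinearMap.finrank_le_finrank_of_injective hR

/-- If the dimensions of two spaces of functions on a finite set add up to more than the number of
points, then for each nonnegative `p` some nonzero sum of squares from the first space, multiplied
by `p`, is a sum of squares from the second. -/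
theorem exists_mul_sum_sq_eq_sum_sq {ι κ X : Type*} [Fintype ι] [Fintype κ] [Fintype X]
    (A : (ι → ℝ) →ₗ[ℝ] (X → ℝ)) (B : (κ → ℝ) →ₗ[ℝ] (X → ℝ))
    (hA : Function.Injective A) (hB : Function.Injective B) (p : X → ℝ) (hp : ∀ x, 0 ≤ p x)
    (hcard : Fintype.card X < Fintype.card ι + Fintype.card κ) :
    ∃ (m : ℕ) (a : Fin m → ι → ℝ) (b : Fin m → κ → ℝ),
      (∀ x, p x * ∑ i, A (a i) x ^ 2 = ∑ i, B (b i) x ^ 2) ∧ ∃ x, ∑ i, A (a i) x ^ 2 ≠ 0 := by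
  classical
  let F : (ι → ℝ) × (κ → ℝ) → X → ℝ := fun c x => B c.2 x ^ 2 - p x * A c.1 x ^ 2
  have hF : Continuous F := by
    have h1 : Continuous A := A.continuous_of_finiteDimensional
    have h2 : Continuous B := B.continuous_of_finiteDimensional
    fun_prop
  let S := F '' Metric.sphere 0 1
  have hS : IsCompact (convexHull ℝ S) :=
    isCompact_convexHull_of_finiteDimensional ((isCompact_sphere _ _).image hF)
  by_cases h0 : (0 : X → ℝ) ∈ convexHull ℝ S
  · obtain ⟨J, _, w, z, hw, hw1, hz, hsum⟩ := mem_convexHull_iff_exists_fintype.1 h0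
    choose c hc hcz using hz
    let e := (Fintype.equivFin J).symm
    have hsqA : ∀ x, ∑ i, A (√(w (e i)) • (c (e i)).1) x ^ 2 = ∑ j, w j * A (c j).1 x ^ 2 := by
      intro x
      rw [← e.sum_comp]
      simp [mul_pow, Real.sq_sqrt (hw _)]
    have hsqB : ∀ x, ∑ i, B (√(w (e i)) • (c (e i)).2) x ^ 2 = ∑ j, w j * B (c j).2 x ^ 2 := by
      intro x
      rw [← e.sum_comp]
      simp [mul_pow, Real.sq_sqrt (hw _)]
    have heq : ∀ x, p x * ∑ j, w j * A (c j).1 x ^ 2 = ∑ j, w j * B (c j).2 x ^ 2 := by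
      intro x
      have := congrFun hsum x
      simp only [← hcz, Finset.sum_apply, Pi.smul_apply, smul_eq_mul, F, Pi.zero_apply, mul_sub,
        Finset.sum_sub_distrib] at this
      rw [Finset.mul_sum, eq_comm, ← sub_eq_zero, ← this]
      congr 1
      exact Finset.sum_congr rfl fun _ _ => by ring
    refine ⟨Fintype.card J, fun i => √(w (e i)) • (c (e i)).1,
      fun i => √(w (e i)) • (c (e i)).2, fun x => by rw [hsqA, hsqB, heq], ?_⟩
    by_contra! hall
    simp only [hsqA] at hall
    obtain ⟨j, hj⟩ : ∃ j, 0 < w j := by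
      by_contra! hn
      have : ∑ j, w j ≤ 0 := Finset.sum_nonpos fun j _ => hn j
      linarith
    have h1 : (c j).1 = 0 := by
      apply hA
      funext x
      have := (Finset.sum_eq_zero_iff_of_nonneg
        fun j _ => mul_nonneg (hw j) (sq_nonneg _)).1 (hall x) j (Finset.mem_univ _)
      simpa [hj.ne'] using this
    have h2 : (c j).2 = 0 := by
      apply hB
      funext x
      have := (Finset.sum_eq_zero_iff_of_nonneg
        fun j _ => mul_nonneg (hw j) (sq_nonneg _)).1
          ((heq x).symm.trans (by rw [hall, mul_zero])) j (Finset.mem_univ _)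
      simpa [hj.ne'] using this
    have h3 : c j = 0 := Prod.ext h1 h2
    have := hc j
    simp [h3] at this
  · exfalso
    obtain ⟨f, u, hu, hfu⟩ :=
      geometric_hahn_banach_point_closed (convex_convexHull ℝ S) hS.isClosed h0
    rw [map_zero] at hu
    let μ : X → ℝ := fun x => f (Pi.single x 1)
    have hf : ∀ z : X → ℝ, f z = ∑ x, μ x * z x := by
      intro z
      conv_lhs => rw [pi_eq_sum_univ' z]
      simp [μ, mul_comm]
    have hpos : ∀ c, c ≠ 0 → 0 < ∑ x, μ x * F c x := by
      intro c hc
      have hn : 0 < ‖c‖ := norm_pos_iff.2 hc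
      have hmem : F (‖c‖⁻¹ • c) ∈ S :=
        ⟨_, by simp [norm_smul, hn.ne'], rfl⟩
      have hlt := hu.trans (hfu _ (subset_convexHull ℝ S hmem))
      have hscale : F (‖c‖⁻¹ • c) = (‖c‖⁻¹ ^ 2) • F c := by
        funext x
        simp only [F, Prod.smul_fst, Prod.smul_snd, map_smul, Pi.smul_apply, smul_eq_mul]
        ring
      rw [hscale, map_smul, smul_eq_mul, hf] at hlt
      exact pos_of_mul_pos_right hlt (by positivity)
    have hκ := card_le_card_pos_of_forall_sum_pos B μ fun b hb => by
      have := hpos (0, b) (by simpa [Prod.ext_iff] using hb)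
      simpa [F] using this
    have hι := card_le_card_pos_of_forall_sum_pos A (fun x => -(μ x * p x)) fun a ha => by
      have := hpos (a, 0) (by simpa [Prod.ext_iff] using ha)
      simpa [F, mul_assoc] using this
    have hdisj : Disjoint (Finset.univ.filter fun x => 0 < -(μ x * p x))
        (Finset.univ.filter fun x => 0 < μ x) := by
      rw [Finset.disjoint_filter]
      intro x _ h1 h2
      have := mul_nonneg h2.le (hp x)
      linarith
    have := Finset.card_le_univ (Finset.disjUnion _ _ hdisj)
    rw [Finset.card_disjUnion] at this
    omega

/-- The polynomial with given coefficients on the squarefree monomials of degree at most `j`. -/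
noncomputable def squarefreePoly (n j : ℕ) :
    ({T : Finset (Fin n) // T.card ≤ j} → ℝ) →ₗ[ℝ] MvPolynomial (Fin n) ℝ :=
  Fintype.linearCombination ℝ fun T => ∏ i ∈ T.1, MvPolynomial.X i

/-- The vertex of the hypercube that is the indicator vector of `S`. -/
noncomputable def cubePoint {n : ℕ} (S : Finset (Fin n)) : Fin n → ℝ :=
  fun i => if i ∈ S then 1 else 0

theorem cubePoint_mem_cube {n : ℕ} (S : Finset (Fin n)) : cubePoint S ∈ cube n := by
  intro i
  by_cases h : i ∈ S <;> simp [cubePoint, h]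

theorem exists_cubePoint_eq {n : ℕ} {x : Fin n → ℝ} (hx : x ∈ cube n) :
    ∃ S, cubePoint S = x := by
  classical
  refine ⟨Finset.univ.filter fun i => x i = 1, ?_⟩
  funext i
  rcases hx i with h | h <;> simp [cubePoint, h]

theorem totalDegree_squarefreePoly_le (n j : ℕ) (c : {T : Finset (Fin n) // T.card ≤ j} → ℝ) :
    (squarefreePoly n j c).totalDegree ≤ j := by
  rw [squarefreePoly, Fintype.linearCombination_apply]
  refine MvPolynomial.totalDegree_finsetSum_le fun T _ => ?_
  refine (MvPolynomial.totalDegree_smul_le _ _).trans ?_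
  refine (MvPolynomial.totalDegree_finsetProd _ _).trans ?_
  simpa [MvPolynomial.totalDegree_X] using T.2

/-- Evaluation of squarefree polynomials at the vertices of the hypercube. -/
noncomputable def squarefreeEval (n j : ℕ) :
    ({T : Finset (Fin n) // T.card ≤ j} → ℝ) →ₗ[ℝ] (Finset (Fin n) → ℝ) :=
  LinearMap.pi (fun S => (MvPolynomial.aeval (cubePoint S)).toLinearMap) ∘ₗ squarefreePoly n j

theorem squarefreeEval_apply (n j : ℕ) (c : {T : Finset (Fin n) // T.card ≤ j} → ℝ)
    (S : Finset (Fin n)) :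
    squarefreeEval n j c S = MvPolynomial.eval (cubePoint S) (squarefreePoly n j c) := by
  simp [squarefreeEval, MvPolynomial.aeval_eq_eval]

theorem squarefreeEval_injective (n j : ℕ) : Function.Injective (squarefreeEval n j) := by
  classical
  rw [← LinearMap.ker_eq_bot, LinearMap.ker_eq_bot']
  intro c hc
  have hsum : ∀ S : Finset (Fin n), ∑ T, c T * (if T.1 ⊆ S then 1 else 0) = 0 := by
    intro S
    have h0 : squarefreeEval n j c S = 0 := congrFun hc S
    rw [squarefreeEval_apply, squarefreePoly, Fintype.linearCombination_apply, map_sum] at h0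
    refine (Finset.sum_congr rfl fun T _ => ?_).trans h0
    simp [MvPolynomial.smul_eval, cubePoint, Finset.prod_ite_zero, Finset.subset_iff]
  have hzero : ∀ (S : Finset (Fin n)) (hS : S.card ≤ j), c ⟨S, hS⟩ = 0 := by
    intro S
    induction S using Finset.strongInduction with
    | H S ih =>
      intro hS
      have := hsum S
      rw [Finset.sum_eq_single ⟨S, hS⟩] at this
      · simpa using this
      · intro T _ hT
        by_cases hTS : T.1 ⊆ S
        · have : T.1 ⊂ S := hTS.ssubset_of_ne fun h => hT (Subtype.ext h)
          rw [ih T.1 this T.2, zero_mul]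
        · simp [hTS]
      · simp
  funext T
  exact hzero T.1 T.2

theorem card_finset_lt_card_le_add_card_le (n : ℕ) :
    Fintype.card (Finset (Fin n)) < Fintype.card {T : Finset (Fin n) // T.card ≤ n / 2} +
      Fintype.card {T : Finset (Fin n) // T.card ≤ n / 2 + 1} := by
  classical
  rw [Fintype.card_subtype, Fintype.card_subtype]
  set L := Finset.univ.filter fun T : Finset (Fin n) => T.card ≤ n / 2
  set M := Finset.univ.filter fun T : Finset (Fin n) => T.card ≤ n / 2 + 1
  let L' := L.image fun T => Tᶜ
  have hmem : ∀ T : Finset (Fin n), T ∈ L' ↔ n - T.card ≤ n / 2 := by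
    intro T
    constructor
    · intro h
      obtain ⟨U, hU, rfl⟩ := Finset.mem_image.1 h
      have hU : U.card ≤ n / 2 := by simpa [L] using hU
      have := Finset.card_le_univ U
      simp only [Finset.card_compl, Fintype.card_fin] at this ⊢
      omega
    · intro h
      exact Finset.mem_image.2 ⟨Tᶜ, by simpa [L, Finset.card_compl] using h, compl_compl T⟩
  have hL : L'.card = L.card := Finset.card_image_of_injective _ compl_injective
  have hunion : L' ∪ M = Finset.univ := by
    ext T
    simp only [Finset.mem_union, hmem, M, Finset.mem_filter, Finset.mem_univ, true_and, iff_true]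
    omega
  have hinter : (L' ∩ M).Nonempty := by
    obtain ⟨T, -, hT⟩ := Finset.exists_subset_card_eq
      (show n - n / 2 ≤ (Finset.univ : Finset (Fin n)).card by simp)
    refine ⟨T, ?_⟩
    simp only [Finset.mem_inter, hmem, M, Finset.mem_filter, Finset.mem_univ, true_and]
    omega
  have := Finset.card_union_add_card_inter L' M
  rw [hunion, Finset.card_univ] at this
  have := hinter.card_pos
  omega

theorem stmt3 (n k : ℕ) (hk : k = n / 2) (p : MvPolynomial (Fin n) ℝ)
    (hdeg : p.totalDegree ≤ 2) (hpos : ∀ x ∈ cube n, 0 ≤ MvPolynomial.eval x p) :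
    ∃ h : (Fin n → ℝ) → ℝ, IsSosOn n (cube n) k h ∧ (∃ x ∈ cube n, h x ≠ 0) ∧
      IsSosOn n (cube n) (k + 1) (fun x => MvPolynomial.eval x p * h x) := by
  subst hk
  obtain ⟨m, a, b, hab, S, hS⟩ := exists_mul_sum_sq_eq_sum_sq
    (squarefreeEval n (n / 2)) (squarefreeEval n (n / 2 + 1))
    (squarefreeEval_injective _ _) (squarefreeEval_injective _ _)
    (fun S => MvPolynomial.eval (cubePoint S) p) (fun S => hpos _ (cubePoint_mem_cube S))
    (card_finset_lt_card_le_add_card_le n)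
  simp only [squarefreeEval_apply] at hab hS
  refine ⟨fun x => ∑ i, MvPolynomial.eval x (squarefreePoly n (n / 2) (a i)) ^ 2,
    ⟨m, _, fun i => totalDegree_squarefreePoly_le _ _ (a i), fun _ _ => rfl⟩,
    ⟨cubePoint S, cubePoint_mem_cube S, hS⟩,
    ⟨m, _, fun i => totalDegree_squarefreePoly_le _ _ (b i), fun x hx => ?_⟩⟩
  obtain ⟨T, rfl⟩ := exists_cubePoint_eq hx
  exact hab T
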